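/- arXiv:2110.15462 — 2 statements merged into one kernel-verified Lean document; each statement's English description precedes it below -/
import Mathlib

section
/- For every β ∈ (π/2, π) there exists ε ∈ (0, 1) such that for all A ∈ (1 − ε, 1) and all σ with 0 < σ < (2/(−cos β))·(1 − A), the inequality tan β < A(1 − A² − 2σ²)/(σ(1 − A²)) holds. -/
/-- For `A` sufficiently close to `1`, the constraint (C8') holds along any locus
`σ < (2/(−cos β))(1 − A)`. -/
theorem C8prime_near_corner :
    ∀ β ∈ Set.Ioo (Real.pi / 2) Real.pi,
      ∃ ε ∈ Set.Ioo (0:ℝ) 1, ∀ A σ : ℝ,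
        1 - ε < A → A < 1 → 0 < σ → σ < (2 / (-Real.cos β)) * (1 - A) →
        Real.tan β < A * (1 - A ^ 2 - 2 * σ ^ 2) / (σ * (1 - A ^ 2)) := by
  intro β hβ
  obtain ⟨h1, h2⟩ := hβ
  have hc : Real.cos β < 0 :=
    Real.cos_neg_of_pi_div_two_lt_of_lt h1 (by linarith [Real.pi_pos])
  have hs : 0 < Real.sin β := Real.sin_pos_of_pos_of_lt_pi (by linarith [Real.pi_pos]) h2
  have ht : Real.tan β < 0 := by
    rw [Real.tan_eq_sin_div_cos]
    exact div_neg_of_pos_of_neg hs hc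
  have hc1 : -1 ≤ Real.cos β := Real.neg_one_le_cos β
  obtain ⟨c, hcd⟩ : ∃ c, c = -Real.cos β := ⟨_, rfl⟩
  have c0 : 0 < c := by linarith
  have c1 : c ≤ 1 := by linarith
  have c2 : c ^ 2 ≤ 1 := by nlinarith
  refine ⟨c ^ 2 / 8, ⟨by positivity, by linarith⟩, ?_⟩
  intro A σ hA hA1 hσ hσA
  rw [← hcd] at hσA
  have hA0 : 0 < A := by linarith
  have hcs : c * σ < 2 * (1 - A) := by
    have h := mul_lt_mul_of_pos_left hσA c0
    have e : c * (2 / c * (1 - A)) = 2 * (1 - A) := by field_simp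
    linarith
  have hsq : (c * σ) ^ 2 < (2 * (1 - A)) ^ 2 :=
    pow_lt_pow_left₀ hcs (by positivity) (by norm_num)
  have hb : (1 - A) * (8 * (1 - A)) < (1 - A) * c ^ 2 :=
    mul_lt_mul_of_pos_left (by linarith) (by linarith)
  have h3 : c ^ 2 * (2 * σ ^ 2) < c ^ 2 * (1 - A) := by nlinarith
  have h4 : 2 * σ ^ 2 < 1 - A := lt_of_mul_lt_mul_left h3 (by positivity)
  have h5 : 0 < 1 - A ^ 2 - 2 * σ ^ 2 := by nlinarith
  have h6 : 0 < 1 - A ^ 2 := by nlinarith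
  exact ht.trans (by positivity)
end

section
/- For every β ∈ (π/2, π) there exist ε ∈ (0, 1), a constant C > 0, and a continuous function σ : (1 − ε, 1) → ℝ such that for every A ∈ (1 − ε, 1): (a) 0 < σ(A) < √(1 − A²); (b) setting λ = (A cos β + σ(A) sin β)/(1 − A² − σ(A)²), a_ℓ = √( ((2A² + 2σ(A)² − 1) A cos β + σ(A) sin β)/(A cos β + σ(A) sin β) ), θ̄₁ = arcsin(A/√(A² + σ(A)²)) − β, and z̄ = A·arccosh(√(A² + σ(A)²)/A), these quantities are well defined with λ < 0 and 0 < a_ℓ < 1, and the equation z̄ − (1/(2λ)) ∫_{θ̄₁}^{π} [ sin²x / √(sin²x + 4λ² a_ℓ²) − sin x ] dx = 0 holds (i.e. the inner exterior nodoid meets the substrate exactly at tangent angle π, corresponding to contact angle θ_c = π); (c) σ(A) is the unique number in (0, √(1 − A²)) with property (b) for this value of A; and (d) | σ(A) − ((sin β + 1)/(−cos β))·(1 − A) | ≤ C (1 − A)² for all A ∈ (1 − ε, 1), so in particular σ(A) → 0 as A → 1⁻. -/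
/-- The inverse hyperbolic cosine, `arcosh : [1,∞) → [0,∞)`. -/
noncomputable def arcosh (x : ℝ) : ℝ := Real.log (x + Real.sqrt (x ^ 2 - 1))

/-- The steady-state condition for contact angle `θ_c = π` with grain-boundary
parameters `(A, s)` and Herring angle `β`: the derived quantities are admissible
(`λ < 0`, `0 < a_ℓ < 1`) and the inner exterior nodoid meets the substrate exactly
at tangent angle `π`, i.e. `z₁(π) = 0`. -/
noncomputable def SteadyStatePi (β A s : ℝ) : Prop :=
  let lam := (A * Real.cos β + s * Real.sin β) / (1 - A ^ 2 - s ^ 2)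
  let aℓ := Real.sqrt (((2 * A ^ 2 + 2 * s ^ 2 - 1) * A * Real.cos β + s * Real.sin β)
      / (A * Real.cos β + s * Real.sin β))
  let θ1 := Real.arcsin (A / Real.sqrt (A ^ 2 + s ^ 2)) - β
  let zbar := A * arcosh (Real.sqrt (A ^ 2 + s ^ 2) / A)
  lam < 0 ∧ 0 < aℓ ∧ aℓ < 1 ∧
    zbar - (1 / (2 * lam)) *
      (∫ x in θ1..Real.pi,
        ((Real.sin x) ^ 2 / Real.sqrt ((Real.sin x) ^ 2 + 4 * lam ^ 2 * aℓ ^ 2)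
          - Real.sin x)) = 0


theorem ars_le {x y : ℝ} (hxy : x ≤ y) : Real.arsinh y - Real.arsinh x ≤ y - x := by
  have : Monotone (fun x => x - Real.arsinh x) := by
    apply monotone_of_deriv_nonneg (differentiable_id.sub Real.differentiable_arsinh)
    intro x
    have h := ((hasDerivAt_id x).sub (Real.hasDerivAt_arsinh x)).deriv
    rw [h, sub_nonneg]
    apply inv_le_one_of_one_le₀
    rw [Real.one_le_sqrt]; nlinarith [sq_nonneg x]
  have := this hxy
  simp only at this
  linarith

theorem ars_slope {x y : ℝ} (hx : 0 ≤ x) (hxy : x ≤ y) (hy : y ≤ 1) :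
    (y - x) / 2 ≤ Real.arsinh y - Real.arsinh x := by
  have : MonotoneOn (fun x => Real.arsinh x - x / 2) (Set.Icc 0 1) := by
    have hd : Differentiable ℝ (fun x => Real.arsinh x - x / 2) :=
      Real.differentiable_arsinh.sub (differentiable_id.div_const 2)
    apply monotoneOn_of_deriv_nonneg (convex_Icc 0 1) hd.continuous.continuousOn
      hd.differentiableOn
    intro x hx
    rw [interior_Icc] at hx
    have h := ((Real.hasDerivAt_arsinh x).sub ((hasDerivAt_id x).div_const 2)).deriv
    have e : deriv (fun x => Real.arsinh x - x / 2) x = (√(1 + x ^ 2))⁻¹ - 1 / 2 := h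
    rw [e, sub_nonneg]
    rw [one_div]
    apply inv_anti₀ (Real.sqrt_pos.2 (by positivity))
    rw [Real.sqrt_le_left (by norm_num)]; nlinarith [hx.1, hx.2]
  have := this ⟨hx, by linarith⟩ ⟨by linarith, hy⟩ hxy
  simp only at this
  linarith

theorem ars_quad {x : ℝ} (hx : 0 ≤ x) : x - x ^ 2 ≤ Real.arsinh x := by
  have : MonotoneOn (fun x => Real.arsinh x - (x - x ^ 2)) (Set.Ici 0) := by
    have hd : Differentiable ℝ (fun x => Real.arsinh x - (x - x ^ 2)) :=
      Real.differentiable_arsinh.sub (differentiable_id.sub (differentiable_id.pow 2))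
    apply monotoneOn_of_deriv_nonneg (convex_Ici 0) hd.continuous.continuousOn
      hd.differentiableOn
    intro x hx
    rw [interior_Ici] at hx
    have hx : 0 < x := hx
    have h := ((Real.hasDerivAt_arsinh x).sub ((hasDerivAt_id x).sub ((hasDerivAt_id x).pow 2))).deriv
    have e : deriv (fun x => Real.arsinh x - (x - x ^ 2)) x = (√(1 + x ^ 2))⁻¹ - (1 - 2 * x) := by
      refine Eq.trans h ?_
      simp
    rw [e, sub_nonneg]
    have h1 : √(1 + x ^ 2) ≤ 1 + x := by
      rw [Real.sqrt_le_left (by positivity)]; nlinarith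
    have h2 : (1 + x)⁻¹ ≤ (√(1 + x ^ 2))⁻¹ := inv_anti₀ (Real.sqrt_pos.2 (by positivity)) h1
    have h3 : 1 - 2 * x ≤ (1 + x)⁻¹ := by
      rw [inv_eq_one_div, le_div_iff₀ (by positivity)]; nlinarith
    linarith
  have := this (Set.mem_Ici.2 le_rfl) (Set.mem_Ici.2 hx) hx
  simp only [Real.arsinh_zero] at this
  linarith

set_option maxHeartbeats 2000000 in
theorem core (H : ℝ → ℝ → ℝ) (H0 K r0 δ : ℝ) (hr0 : 0 < r0) (hδ : 0 < δ) (hK : 0 ≤ K)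
    (hH0 : H 1 0 = H0) (hneg : H0 < 0)
    (lip : ∀ A s A' s', |A - 1| ≤ r0 → |s| ≤ r0 → |A' - 1| ≤ r0 → |s'| ≤ r0 →
      |H A s - H A' s'| ≤ K * (|A - A'| + |s - s'|)) :
    ∃ ε ∈ Set.Ioo (0:ℝ) 1, ε ≤ δ ∧ (∀ A ∈ Set.Ioo (1 - ε) 1, √(1 - A ^ 2) ≤ δ) ∧
      ∃ C : ℝ, 0 < C ∧ ∃ σ : ℝ → ℝ,
        ContinuousOn σ (Set.Ioo (1 - ε) 1) ∧
        (∀ A ∈ Set.Ioo (1 - ε) 1,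
          (0 < σ A ∧ σ A < √(1 - A ^ 2)) ∧
          A * Real.arsinh (σ A / A) + (1 - A ^ 2 - (σ A) ^ 2) * H A (σ A) = 0 ∧
          (∀ s : ℝ, 0 < s → s < √(1 - A ^ 2) →
            A * Real.arsinh (s / A) + (1 - A ^ 2 - s ^ 2) * H A s = 0 → s = σ A) ∧
          |σ A + 2 * H0 * (1 - A)| ≤ C * (1 - A) ^ 2) ∧
        Filter.Tendsto σ (nhdsWithin 1 (Set.Iio 1)) (nhds 0) := by
  set M : ℝ := |H0| + 2 * K + 1 with hM
  have hMpos : 0 < M := by positivity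
  obtain ⟨r, hr, hrr0, hrδ, hr4, hrM, hrK⟩ : ∃ r : ℝ, 0 < r ∧ r ≤ r0 ∧ r ≤ δ ∧ r ≤ 1/4 ∧
      r * (20 * M) ≤ 1 ∧ r * (4 * (K + 1)) ≤ -H0 := by
    refine ⟨min r0 (min δ (min (1/4) (min (1 / (20 * M)) (-H0 / (4 * (K + 1)))))), ?_, ?_, ?_, ?_, ?_, ?_⟩
    · have : 0 < -H0 / (4 * (K + 1)) := div_pos (by linarith) (by linarith)
      have : 0 < 1 / (20 * M) := by positivity
      simp only [lt_min_iff]; refine ⟨hr0, hδ, by norm_num, by assumption, by assumption⟩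
    · exact min_le_left _ _
    · exact (min_le_right _ _).trans (min_le_left _ _)
    · exact (min_le_right _ _).trans ((min_le_right _ _).trans (min_le_left _ _))
    · rw [← le_div_iff₀ (by positivity)]
      exact (min_le_right _ _).trans ((min_le_right _ _).trans ((min_le_right _ _).trans (min_le_left _ _)))
    · rw [← le_div_iff₀ (by positivity)]
      exact (min_le_right _ _).trans ((min_le_right _ _).trans ((min_le_right _ _).trans (min_le_right _ _)))
  have hKM : 2 * K ≤ M := by rw [hM]; linarith [abs_nonneg H0]
  have Hnear : ∀ A s, |A - 1| ≤ r → |s| ≤ r → |H A s - H0| ≤ K * (|A - 1| + |s|) := by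
    intro A s hA hs
    have := lip A s 1 0 (hA.trans hrr0) (hs.trans hrr0) (by simpa using hr0.le) (by simpa using hr0.le)
    rw [hH0, sub_zero] at this
    exact this
  have HM : ∀ A s, |A - 1| ≤ r → |s| ≤ r → |H A s| ≤ M := by
    intro A s hA hs
    have h1 := Hnear A s hA hs
    have h2 : K * (|A - 1| + |s|) ≤ K * 1 := by gcongr; linarith
    have h3 : |H A s| ≤ |H A s - H0| + |H0| := by
      have := abs_add_le (H A s - H0) H0; simpa using this
    rw [hM]; linarith
  have Hneg : ∀ A s, |A - 1| ≤ r → |s| ≤ r → H A s < 0 := by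
    intro A s hA hs
    have h1 := (abs_le.1 (Hnear A s hA hs)).2
    have h2 : K * (|A - 1| + |s|) ≤ K * (2 * r) := by gcongr; linarith
    nlinarith
  set F : ℝ → ℝ → ℝ := fun A s => A * Real.arsinh (s / A) + (1 - A ^ 2 - s ^ 2) * H A s with hF
  have slope : ∀ A s s', |A - 1| ≤ r → 0 ≤ s' → s' ≤ s → s ≤ r → (s - s') / 4 ≤ F A s - F A s' := by
    intro A s s' hA h0 h1 h2
    have hA' := abs_le.1 hA
    have hApos : 0 < A := by linarith
    have hz := ars_slope (x := s' / A) (y := s / A) (by positivity) (by gcongr)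
      (by rw [div_le_one hApos]; linarith)
    have hz' : (s - s') / 2 ≤ A * (Real.arsinh (s / A) - Real.arsinh (s' / A)) := by
      calc (s - s') / 2 = A * ((s / A - s' / A) / 2) := by field_simp
        _ ≤ _ := by gcongr
    have e1 : |s| = s := abs_of_nonneg (h0.trans h1)
    have e1' : |s'| = s' := abs_of_nonneg h0
    have hl := lip A s A s' (hA.trans hrr0) (by linarith) (hA.trans hrr0) (by linarith)
    rw [sub_self, abs_zero, zero_add, abs_of_nonneg (sub_nonneg.2 h1)] at hl
    have hD : |1 - A ^ 2 - s ^ 2| ≤ 3 * r := by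
      rw [abs_le]; constructor <;> nlinarith
    have hm := HM A s' hA (by linarith)
    have k1 : |(1 - A ^ 2 - s ^ 2) * (H A s - H A s')| ≤ 3 * r * (K * (s - s')) := by
      rw [abs_mul]; gcongr
    have k2 : |(s' ^ 2 - s ^ 2) * H A s'| ≤ (2 * r * (s - s')) * M := by
      rw [abs_mul]
      gcongr
      rw [abs_le]; constructor <;> nlinarith
    have k3 := (abs_le.1 k1).1
    have k4 := (abs_le.1 k2).1
    have k5 : 3 * r * (K * (s - s')) + (2 * r * (s - s')) * M ≤ (s - s') / 4 := by
      have : 3 * r * K + 2 * r * M ≤ 1 / 4 := by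
        have := mul_le_mul_of_nonneg_left hKM hr.le
        linarith
      have := mul_le_mul_of_nonneg_right this (sub_nonneg.2 h1)
      linarith
    have : F A s - F A s' = A * (Real.arsinh (s / A) - Real.arsinh (s' / A)) +
      (1 - A ^ 2 - s ^ 2) * (H A s - H A s') + (s' ^ 2 - s ^ 2) * H A s' := by
      simp only [hF]; ring
    linarith
  have slope' : ∀ A s s', |A - 1| ≤ r → 0 ≤ s' → s' ≤ r → 0 ≤ s → s ≤ r →
      |s - s'| ≤ 4 * |F A s - F A s'| := by
    intro A s s' hA h1 h2 h3 h4
    rcases le_total s' s with h | h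
    · have := slope A s s' hA h1 h h4
      rw [abs_of_nonneg (sub_nonneg.2 h)]
      linarith [le_abs_self (F A s - F A s')]
    · have := slope A s' s hA h3 h h2
      rw [abs_of_nonpos (sub_nonpos.2 h)]
      linarith [neg_abs_le (F A s - F A s')]
  have Hcont : ContinuousOn (fun p : ℝ × ℝ => H p.1 p.2) {p | |p.1 - 1| ≤ r ∧ |p.2| ≤ r} := by
    intro p hp
    rw [ContinuousWithinAt, tendsto_iff_norm_sub_tendsto_zero]
    refine squeeze_zero' (g := fun q : ℝ × ℝ => K * (|q.1 - p.1| + |q.2 - p.2|)) 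
      (Filter.Eventually.of_forall fun _ => norm_nonneg _) ?_ ?_
    · filter_upwards [self_mem_nhdsWithin] with q hq
      exact lip _ _ _ _ (hq.1.trans hrr0) (hq.2.trans hrr0) (hp.1.trans hrr0) (hp.2.trans hrr0)
    · have : Continuous (fun q : ℝ × ℝ => K * (|q.1 - p.1| + |q.2 - p.2|)) := by fun_prop
      have := (this.tendsto p).mono_left (nhdsWithin_le_nhds (s := {p | |p.1 - 1| ≤ r ∧ |p.2| ≤ r}))
      simpa using this
  have Fcont : ContinuousOn (fun p : ℝ × ℝ => F p.1 p.2) {p | |p.1 - 1| ≤ r ∧ |p.2| ≤ r} := by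
    have hne : ∀ p ∈ {p : ℝ × ℝ | |p.1 - 1| ≤ r ∧ |p.2| ≤ r}, p.1 ≠ 0 := by
      rintro p ⟨hp, -⟩ h
      rw [h] at hp; norm_num at hp; linarith
    apply ContinuousOn.add
    · apply ContinuousOn.mul (by fun_prop)
      exact ContinuousOn.arsinh (ContinuousOn.div (by fun_prop) (by fun_prop) hne)
    · exact ContinuousOn.mul (by fun_prop) Hcont
  have hmem : ∀ A ∈ Set.Ioo (1 - r ^ 2 / 2) 1, |A - 1| < r ∧ 1 / 2 < A ∧ 0 < 1 - A ^ 2 ∧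
      √(1 - A ^ 2) ≤ r := by
    rintro A ⟨h1, h2⟩
    have : 1 / 2 < A := by nlinarith
    refine ⟨by rw [abs_lt]; constructor <;> nlinarith, this, by nlinarith, ?_⟩
    rw [Real.sqrt_le_left hr.le]; nlinarith
  have ex : ∀ A ∈ Set.Ioo (1 - r ^ 2 / 2) 1, ∃ s, 0 < s ∧ s < √(1 - A ^ 2) ∧ F A s = 0 := by
    intro A hA
    obtain ⟨h1, h2, h3, h4⟩ := hmem A hA
    have hc : ContinuousOn (fun s => F A s) (Set.Icc 0 (√(1 - A ^ 2))) := by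
      refine Fcont.comp (f := fun s : ℝ => (A, s)) (by fun_prop) ?_
      intro s hs
      refine ⟨h1.le, ?_⟩
      show |s| ≤ r
      rw [abs_of_nonneg hs.1]; exact hs.2.trans h4
    have hq : 0 < √(1 - A ^ 2) := Real.sqrt_pos.2 h3
    have := intermediate_value_Ioo hq.le hc
    have hz : (0:ℝ) ∈ Set.Ioo (F A 0) (F A (√(1 - A ^ 2))) := by
      constructor
      · have := Hneg A 0 h1.le (by simpa using hr.le)
        simp only [hF]
        simp only [zero_div, Real.arsinh_zero]
        nlinarith
      · simp only [hF]
        rw [Real.sq_sqrt h3.le, sub_self, zero_mul, add_zero]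
        apply mul_pos (by linarith)
        rw [Real.arsinh_pos_iff]; apply div_pos hq; linarith
    obtain ⟨s, hs, hs'⟩ := this hz
    exact ⟨s, hs.1, hs.2, hs'⟩
  choose! σ hσ0 hσ1 hσF using ex
  refine ⟨r ^ 2 / 2, ⟨by positivity, by nlinarith⟩, by nlinarith, fun A hA => (hmem A hA).2.2.2.trans hrδ,
    32 * M ^ 2 + 2 * K * (1 + 4 * M) + (1 + 16 * M ^ 2) * M, by positivity, σ, ?_, ?_, ?_⟩
  · intro A0 hA0
    obtain ⟨h1, h2, h3, h4⟩ := hmem A0 hA0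
    have b0 := (hσ1 A0 hA0).le.trans h4
    have hca : ContinuousAt (fun A => F A (σ A0)) A0 := by
      have hc : ContinuousOn (fun A => F A (σ A0)) {A | |A - 1| ≤ r} := by
        refine Fcont.comp (f := fun A : ℝ => (A, σ A0)) (by fun_prop) ?_
        intro A hA
        refine ⟨hA, ?_⟩
        show |σ A0| ≤ r
        rw [abs_of_pos (hσ0 A0 hA0)]; exact b0
      apply hc.continuousAt
      have : Continuous (fun A : ℝ => |A - 1|) := by fun_prop
      filter_upwards [this.continuousAt.eventually_lt (continuousAt_const (y := r)) h1] with A hA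
      exact hA.le
    apply ContinuousAt.continuousWithinAt
    rw [ContinuousAt, tendsto_iff_norm_sub_tendsto_zero]
    have hlim : Filter.Tendsto (fun A => 4 * |F A (σ A0)|) (nhds A0) (nhds 0) := by
      have := (hca.abs.const_mul 4)
      rw [ContinuousAt, hσF A0 hA0] at this
      simpa using this
    refine squeeze_zero' (Filter.Eventually.of_forall fun _ => norm_nonneg _) ?_ hlim
    filter_upwards [Ioo_mem_nhds hA0.1 hA0.2] with A hA
    obtain ⟨g1, g2, g3, g4⟩ := hmem A hA
    have := slope' A (σ A) (σ A0) g1.le (hσ0 A0 hA0).le b0 (hσ0 A hA).le ((hσ1 A hA).le.trans g4)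
    rw [hσF A hA, zero_sub, abs_neg] at this
    exact this
  · intro A hA
    obtain ⟨h1, h2, h3, h4⟩ := hmem A hA
    have b0 := (hσ1 A hA).le.trans h4
    have p0 := hσ0 A hA
    refine ⟨⟨hσ0 A hA, hσ1 A hA⟩, hσF A hA, ?_, ?_⟩
    · intro s hs hs' hs0
      have hs0 : F A s = 0 := hs0
      have := slope' A s (σ A) h1.le p0.le b0 hs.le (hs'.le.trans h4)
      rw [hs0, hσF A hA] at this
      simp only [sub_zero, abs_zero, mul_zero] at this
      have := abs_nonpos_iff.1 this
      linarith
    · have hf := hσF A hA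
      have hsq : (σ A) ^ 2 < 1 - A ^ 2 := by
        have := hσ1 A hA
        rwa [Real.lt_sqrt p0.le] at this
      set s := σ A with hs
      simp only [hF] at hf
      set t := 1 - A with ht
      have htpos : 0 < t := by have := hA.2; linarith
      have hAt : A = 1 - t := by rw [ht]; ring
      have hApos : 0 < A := by linarith
      have has : |s| = s := abs_of_pos p0
      have hat : |A - 1| = t := by rw [abs_of_neg (by linarith)]; linarith
      have hm := HM A s h1.le (by linarith)
      have hn := Hnear A s h1.le (by linarith)
      rw [has, hat] at hn
      have hD0 : 0 < 1 - A ^ 2 - s ^ 2 := by linarith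
      have hD1 : 1 - A ^ 2 - s ^ 2 ≤ 2 * t := by rw [hAt]; nlinarith
      have za := ars_slope (x := 0) (y := s / A) le_rfl (by positivity)
        (by rw [div_le_one hApos]; linarith)
      have zb := ars_le (x := 0) (y := s / A) (by positivity)
      have zc := ars_quad (x := s / A) (by positivity)
      rw [Real.arsinh_zero] at za zb
      simp only [sub_zero] at za zb
      set w := Real.arsinh (s / A) with hw
      have za' : s / 2 ≤ A * w := by
        calc s / 2 = A * ((s / A) / 2) := by field_simp
          _ ≤ _ := by gcongr
      have zb' : A * w ≤ s := by
        calc A * w ≤ A * (s / A) := by gcongr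
          _ = s := by field_simp
      have zc' : s - 2 * s ^ 2 ≤ A * w := by
        have : A * (s / A - (s / A) ^ 2) ≤ A * w := by gcongr
        have e : A * (s / A - (s / A) ^ 2) = s - s ^ 2 / A := by field_simp
        have : s ^ 2 / A ≤ 2 * s ^ 2 := by
          rw [div_le_iff₀ hApos]; nlinarith [sq_nonneg s]
        linarith
      have hst : s ≤ 4 * M * t := by
        have : -((1 - A ^ 2 - s ^ 2) * H A s) ≤ 2 * t * M := by
          rw [← mul_neg]
          calc (1 - A ^ 2 - s ^ 2) * (- H A s) ≤ (1 - A ^ 2 - s ^ 2) * M := by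
                gcongr; linarith [(abs_le.1 hm).1]
            _ ≤ _ := by gcongr
        linarith
      have q1 : |(1 - A ^ 2 - s ^ 2) * (H A s - H0)| ≤ 2 * t * (K * (t + s)) := by
        rw [abs_mul, abs_of_pos hD0]; gcongr
      have q2 : |(t ^ 2 + s ^ 2) * H0| ≤ (t ^ 2 + s ^ 2) * M := by
        rw [abs_mul, abs_of_nonneg (by positivity)]; gcongr
        rw [hM]; linarith
      have q3 : s + 2 * H0 * t = (s - A * w) - (1 - A ^ 2 - s ^ 2) * (H A s - H0) 
          + (t ^ 2 + s ^ 2) * H0 := by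
        have : 1 - A ^ 2 - s ^ 2 = 2 * t - t ^ 2 - s ^ 2 := by rw [hAt]; ring
        linear_combination hf - H0 * this
      have q4 : |s - A * w| ≤ 2 * s ^ 2 := by
        rw [abs_of_nonneg (by linarith)]; linarith
      have s2 : s ^ 2 ≤ 16 * M ^ 2 * t ^ 2 := by
        calc s ^ 2 ≤ (4 * M * t) ^ 2 := by gcongr
          _ = _ := by ring
      rw [q3]
      calc _ ≤ 2 * s ^ 2 + 2 * t * (K * (t + s)) + (t ^ 2 + s ^ 2) * M := by
            refine (abs_add_le _ _).trans (add_le_add ((abs_sub _ _).trans (add_le_add q4 q1)) q2)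
        _ ≤ 2 * (16 * M ^ 2 * t ^ 2) + 2 * t * (K * (t + 4 * M * t)) + (t ^ 2 + 16 * M ^ 2 * t ^ 2) * M := by
            gcongr
        _ = _ := by ring
  · have hl : Filter.Tendsto (fun A : ℝ => √(1 - A ^ 2)) (nhdsWithin 1 (Set.Iio 1)) (nhds 0) := by
      have : Continuous (fun A : ℝ => √(1 - A ^ 2)) := by fun_prop
      have := (this.tendsto 1).mono_left (nhdsWithin_le_nhds (s := Set.Iio 1))
      simpa using this
    have hev : ∀ᶠ A in nhdsWithin (1:ℝ) (Set.Iio 1), A ∈ Set.Ioo (1 - r ^ 2 / 2) 1 :=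
      Ioo_mem_nhdsLT (by nlinarith)
    refine squeeze_zero' ?_ ?_ hl
    · filter_upwards [hev] with A hA using (hσ0 A hA).le
    · filter_upwards [hev] with A hA using (hσ1 A hA).le


/-- locally Lipschitz at a point -/
def LipAt {X Y : Type*} [PseudoEMetricSpace X] [PseudoEMetricSpace Y] (f : X → Y) (x : X) : Prop :=
  ∃ K, ∃ t ∈ nhds x, LipschitzOnWith K f t

theorem LipAt.continuousAt {X Y : Type*} [PseudoEMetricSpace X] [PseudoEMetricSpace Y] {f : X → Y} {x : X}
    (h : LipAt f x) : ContinuousAt f x := by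
  obtain ⟨K, t, ht, hf⟩ := h
  exact hf.continuousOn.continuousAt ht

theorem LipAt.comp {X Y Z : Type*} [PseudoEMetricSpace X] [PseudoEMetricSpace Y] [PseudoEMetricSpace Z]
    {g : Y → Z} {f : X → Y} {x : X}
    (hg : LipAt g (f x)) (hf : LipAt f x) : LipAt (fun x => g (f x)) x := by
  have hc := hf.continuousAt
  obtain ⟨K, t, ht, hf⟩ := hf
  obtain ⟨K', t', ht', hg⟩ := hg
  refine ⟨K' * K, t ∩ f ⁻¹' t', Filter.inter_mem ht (hc ht'), ?_⟩
  exact hg.comp (hf.mono Set.inter_subset_left) (fun x hx => hx.2)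

theorem LipAt.prodMk {X Y Z : Type*} [PseudoEMetricSpace X] [PseudoEMetricSpace Y] [PseudoEMetricSpace Z]
    {g : X → Z} {f : X → Y} {x : X}
    (hf : LipAt f x) (hg : LipAt g x) : LipAt (fun x => (f x, g x)) x := by
  obtain ⟨K, t, ht, hf⟩ := hf
  obtain ⟨K', t', ht', hg⟩ := hg
  exact ⟨max K K', t ∩ t', Filter.inter_mem ht ht',
    (hf.mono Set.inter_subset_left).prodMk (hg.mono Set.inter_subset_right)⟩

theorem ContDiffAt.lipAt {X Y : Type*} [NormedAddCommGroup X] [NormedSpace ℝ X]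
    [NormedAddCommGroup Y] [NormedSpace ℝ Y] {f : X → Y} {x : X}
    (h : ContDiffAt ℝ 1 f x) : LipAt f x := h.exists_lipschitzOnWith

/-- the regularised nodoid integrand -/
noncomputable def gInt (d m x : ℝ) : ℝ := (Real.sin x) ^ 2 / √(d ^ 2 * (Real.sin x) ^ 2 + m)

noncomputable def LInt (θ d m : ℝ) : ℝ := ∫ x in θ..Real.pi, gInt d m x

theorem gInt_cont (d : ℝ) {m : ℝ} (hm : 0 < m) : Continuous (gInt d m) := by
  unfold gInt
  apply Continuous.div (by fun_prop) (by fun_prop)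
  intro x
  exact (Real.sqrt_pos.2 (by positivity)).ne'

theorem inv_sqrt_lip {n a b : ℝ} (hn : 0 < n) (ha : n ^ 2 ≤ a) (hb : n ^ 2 ≤ b) :
    |1 / √a - 1 / √b| ≤ |a - b| / n ^ 3 := by
  have ha' : n ≤ √a := Real.le_sqrt_of_sq_le ha
  have hb' : n ≤ √b := Real.le_sqrt_of_sq_le hb
  have ea : √a ^ 2 = a := Real.sq_sqrt (by nlinarith)
  have eb : √b ^ 2 = b := Real.sq_sqrt (by nlinarith)
  set u := √a
  set v := √b
  have hu : 0 < u := by linarith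
  have hv : 0 < v := by linarith
  have e : 1 / u - 1 / v = -(a - b) / (u * v * (u + v)) := by
    rw [← ea, ← eb]; field_simp; ring
  rw [e, abs_div, abs_neg, abs_of_pos (by positivity : 0 < u * v * (u + v))]
  gcongr
  calc n ^ 3 = n * n * n := by ring
    _ ≤ u * v * (u + v) := by gcongr; linarith

theorem gInt_bound {n d m : ℝ} (hn : 0 < n) (hm : n ^ 2 ≤ m) (x : ℝ) : |gInt d m x| ≤ 1 / n := by
  have : n ≤ √(d ^ 2 * (Real.sin x) ^ 2 + m) := Real.le_sqrt_of_sq_le (by nlinarith [mul_nonneg (sq_nonneg d) (sq_nonneg (Real.sin x))])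
  unfold gInt
  rw [abs_div, abs_of_nonneg (by positivity), abs_of_nonneg (Real.sqrt_nonneg _)]
  gcongr
  exact Real.sin_sq_le_one x

theorem gInt_lip {n d m d' m' : ℝ} (hn : 0 < n) (hm : n ^ 2 ≤ m) (hm' : n ^ 2 ≤ m')
    (hd : |d| ≤ 1) (hd' : |d'| ≤ 1) (x : ℝ) :
    |gInt d m x - gInt d' m' x| ≤ (2 * |d - d'| + |m - m'|) / n ^ 3 := by
  unfold gInt
  set q := (Real.sin x) ^ 2
  have hq : 0 ≤ q := sq_nonneg _
  have hq1 : q ≤ 1 := Real.sin_sq_le_one x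
  have h := inv_sqrt_lip (a := d ^ 2 * q + m) (b := d' ^ 2 * q + m') hn (by nlinarith [mul_nonneg (sq_nonneg d) hq])
    (by nlinarith [mul_nonneg (sq_nonneg d') hq])
  have e : q / √(d ^ 2 * q + m) - q / √(d' ^ 2 * q + m') =
    q * (1 / √(d ^ 2 * q + m) - 1 / √(d' ^ 2 * q + m')) := by ring
  rw [e, abs_mul, abs_of_nonneg hq]
  have h2 : |d ^ 2 * q + m - (d' ^ 2 * q + m')| ≤ 2 * |d - d'| + |m - m'| := by
    have e2 : d ^ 2 * q + m - (d' ^ 2 * q + m') = ((d + d') * q) * (d - d') + (m - m') := by ring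
    rw [e2]
    refine (abs_add_le _ _).trans ?_
    rw [abs_mul ((d + d') * q), abs_mul, abs_of_nonneg hq]
    have h3 : |d + d'| ≤ 2 := (abs_add_le _ _).trans (by linarith)
    have : |d + d'| * q ≤ 2 * 1 := by gcongr
    gcongr; linarith
  calc _ ≤ 1 * (|d ^ 2 * q + m - (d' ^ 2 * q + m')| / n ^ 3) := by gcongr
    _ ≤ _ := by rw [one_mul]; gcongr

theorem LInt_lip {n B d m θ d' m' θ' : ℝ} (hn : 0 < n) (hm : n ^ 2 ≤ m) (hm' : n ^ 2 ≤ m')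
    (hd : |d| ≤ 1) (hd' : |d'| ≤ 1) (hθ : |Real.pi - θ| ≤ B) :
    |LInt θ d m - LInt θ' d' m'| ≤
      (2 * |d - d'| + |m - m'|) / n ^ 3 * B + 1 / n * |θ - θ'| := by
  have hmp : 0 < m := lt_of_lt_of_le (by positivity) hm
  have hmp' : 0 < m' := lt_of_lt_of_le (by positivity) hm'
  have i1 : ∀ a b, IntervalIntegrable (gInt d m) MeasureTheory.volume a b :=
    fun a b => (gInt_cont d hmp).intervalIntegrable a b
  have i2 : ∀ a b, IntervalIntegrable (gInt d' m') MeasureTheory.volume a b :=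
    fun a b => (gInt_cont d' hmp').intervalIntegrable a b
  have e : LInt θ d m - LInt θ' d' m' =
      (∫ x in θ..Real.pi, (gInt d m x - gInt d' m' x)) - ∫ x in θ'..θ, gInt d' m' x := by
    unfold LInt
    rw [intervalIntegral.integral_sub (i1 _ _) (i2 _ _),
      ← intervalIntegral.integral_add_adjacent_intervals (i2 θ' θ) (i2 θ Real.pi)]
    ring
  rw [e]
  refine (abs_sub _ _).trans (add_le_add ?_ ?_)
  · refine (intervalIntegral.norm_integral_le_of_norm_le_const
      (f := fun x => gInt d m x - gInt d' m' x) (fun x _ => gInt_lip hn hm hm' hd hd' x)).trans ?_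
    gcongr
  · exact intervalIntegral.norm_integral_le_of_norm_le_const
      (f := gInt d' m') (fun x _ => gInt_bound hn hm' x)

theorem LInt_lipAt (θ0 m0 : ℝ) (hm0 : 0 < m0) :
    LipAt (fun p : ℝ × ℝ × ℝ => LInt p.1 p.2.1 p.2.2) (θ0, 0, m0) := by
  set n := √(m0 / 2) with hn
  have hnp : 0 < n := Real.sqrt_pos.2 (by positivity)
  have hn2 : n ^ 2 = m0 / 2 := Real.sq_sqrt (by positivity)
  set B := |Real.pi - θ0| + 1 with hB
  have hBp : 0 < B := by positivity
  refine ⟨Real.toNNReal ((2 + 1) / n ^ 3 * B + 1 / n), 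
    {p | |p.1 - θ0| < 1 ∧ |p.2.1| < 1 ∧ m0 / 2 < p.2.2}, ?_, ?_⟩
  · have o : IsOpen {p : ℝ × ℝ × ℝ | |p.1 - θ0| < 1 ∧ |p.2.1| < 1 ∧ m0 / 2 < p.2.2} := by
      refine IsOpen.and (isOpen_lt (by fun_prop) (by fun_prop)) ?_
      exact IsOpen.and (isOpen_lt (by fun_prop) (by fun_prop)) (isOpen_lt (by fun_prop) (by fun_prop))
    apply o.mem_nhds
    simp; linarith
  · apply LipschitzOnWith.of_dist_le_mul
    rintro ⟨θ, d, m⟩ ⟨h1, h2, h3⟩ ⟨θ', d', m'⟩ ⟨h1', h2', h3'⟩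
    simp only at h1 h2 h3 h1' h2' h3'
    rw [Real.coe_toNNReal _ (by positivity), Prod.dist_eq, Prod.dist_eq]
    simp only [Real.dist_eq]
    set X := max |θ - θ'| (max |d - d'| |m - m'|)
    have x1 : |θ - θ'| ≤ X := le_max_left _ _
    have x2 : |d - d'| ≤ X := (le_max_left _ _).trans (le_max_right _ _)
    have x3 : |m - m'| ≤ X := (le_max_right _ _).trans (le_max_right _ _)
    have hb : |Real.pi - θ| ≤ B := by
      have : Real.pi - θ = (Real.pi - θ0) - (θ - θ0) := by ring
      rw [this]; exact (abs_sub _ _).trans (by linarith)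
    refine (LInt_lip hnp (by linarith) (by linarith) h2.le h2'.le hb).trans ?_
    calc _ ≤ (2 * X + X) / n ^ 3 * B + 1 / n * X := by gcongr
      _ = _ := by ring

noncomputable def Hfun (β A s : ℝ) : ℝ :=
  (1 + (s * Real.cos β + A * Real.sin β) / √(A ^ 2 + s ^ 2) - (1 - A ^ 2 - s ^ 2) *
    LInt (Real.pi / 2 - Real.arctan (s / A) - β) (1 - A ^ 2 - s ^ 2)
      (4 * (A * Real.cos β + s * Real.sin β) *
        ((A * Real.cos β + s * Real.sin β) - 2 * (1 - A ^ 2 - s ^ 2) * A * Real.cos β)))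
    / (2 * (A * Real.cos β + s * Real.sin β))

theorem Hfun_lipAt (β : ℝ) (hc : Real.cos β < 0) :
    LipAt (fun p : ℝ × ℝ => Hfun β p.1 p.2) (1, 0) := by
  have hL : LipAt (fun p : ℝ × ℝ => LInt (Real.pi / 2 - Real.arctan (p.2 / p.1) - β) (1 - p.1 ^ 2 - p.2 ^ 2)
      (4 * (p.1 * Real.cos β + p.2 * Real.sin β) *
        ((p.1 * Real.cos β + p.2 * Real.sin β) - 2 * (1 - p.1 ^ 2 - p.2 ^ 2) * p.1 * Real.cos β))) (1, 0) := by
    have := LInt_lipAt (Real.pi / 2 - β) (4 * Real.cos β ^ 2) (by nlinarith)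
    refine LipAt.comp (g := fun p : ℝ × ℝ × ℝ => LInt p.1 p.2.1 p.2.2)
      (f := fun p : ℝ × ℝ => (Real.pi / 2 - Real.arctan (p.2 / p.1) - β, 1 - p.1 ^ 2 - p.2 ^ 2,
      4 * (p.1 * Real.cos β + p.2 * Real.sin β) *
        ((p.1 * Real.cos β + p.2 * Real.sin β) - 2 * (1 - p.1 ^ 2 - p.2 ^ 2) * p.1 * Real.cos β))) ?_ ?_
    · convert this using 2
      · simp
      · simp only [Prod.mk.injEq]; constructor <;> ring
    · apply ContDiffAt.lipAt
      have h1 : ContDiffAt ℝ 1 (fun p : ℝ × ℝ => p.2 / p.1) (1, 0) :=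
        contDiffAt_snd.div contDiffAt_fst (by simp)
      have h2 := (Real.contDiff_arctan (n := 1)).contDiffAt.comp _ h1
      apply ContDiffAt.prodMk
      · exact (contDiffAt_const.sub h2).sub contDiffAt_const
      · apply ContDiff.contDiffAt
        fun_prop
  have hid : LipAt (fun p : ℝ × ℝ => p) (1, 0) := contDiffAt_id.lipAt
  refine LipAt.comp (g := fun q : (ℝ × ℝ) × ℝ => (1 + (q.1.2 * Real.cos β + q.1.1 * Real.sin β) / √(q.1.1 ^ 2 + q.1.2 ^ 2) - (1 - q.1.1 ^ 2 - q.1.2 ^ 2) * q.2) / (2 * (q.1.1 * Real.cos β + q.1.2 * Real.sin β))) ?_ (hid.prodMk hL)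
  apply ContDiffAt.lipAt
  apply ContDiffAt.div
  · apply ContDiffAt.sub
    · apply ContDiffAt.add contDiffAt_const
      apply ContDiffAt.div
      · apply ContDiff.contDiffAt; fun_prop
      · apply ContDiffAt.sqrt
        · apply ContDiff.contDiffAt; fun_prop
        · simp
      · simp
    · apply ContDiff.contDiffAt; fun_prop
  · apply ContDiff.contDiffAt; fun_prop
  · simpa using hc.ne

theorem Hfun_lip (β : ℝ) (hc : Real.cos β < 0) : ∃ K r : ℝ, 0 ≤ K ∧ 0 < r ∧
    ∀ A s A' s', |A - 1| ≤ r → |s| ≤ r → |A' - 1| ≤ r → |s'| ≤ r →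
      |Hfun β A s - Hfun β A' s'| ≤ K * (|A - A'| + |s - s'|) := by
  obtain ⟨K, t, ht, h⟩ := Hfun_lipAt β hc
  obtain ⟨r, hr, hrt⟩ := Metric.nhds_basis_closedBall.mem_iff.1 ht
  refine ⟨K, r, K.2, hr, ?_⟩
  intro A s A' s' h1 h2 h3 h4
  have mem : ∀ A s : ℝ, |A - 1| ≤ r → |s| ≤ r → (A, s) ∈ t := by
    intro A s h1 h2
    apply hrt
    rw [Metric.mem_closedBall, Prod.dist_eq]
    simp only [Real.dist_eq, sub_zero]
    exact max_le h1 h2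
  have := h.dist_le_mul _ (mem A s h1 h2) _ (mem A' s' h3 h4)
  rw [Prod.dist_eq] at this
  simp only [Real.dist_eq] at this
  refine this.trans ?_
  gcongr
  exact max_le (by linarith [abs_nonneg (s - s')]) (by linarith [abs_nonneg (A - A')])

theorem arcosh_eq {A s : ℝ} (hA : 0 < A) (hs : 0 < s) :
    arcosh (√(A ^ 2 + s ^ 2) / A) = Real.arsinh (s / A) := by
  have e : √(A ^ 2 + s ^ 2) / A = √(1 + (s / A) ^ 2) := by
    rw [div_eq_iff hA.ne']
    rw [Real.sqrt_eq_iff_mul_self_eq (by positivity) (by positivity)]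
    rw [← sq, mul_pow, Real.sq_sqrt (by positivity)]
    field_simp
  unfold arcosh Real.arsinh
  rw [e, Real.sq_sqrt (by positivity), add_sub_cancel_left, Real.sqrt_sq (by positivity), add_comm]

theorem arcsin_eq_aux {A s : ℝ} (hA : 0 < A) (hs : 0 < s) :
    Real.arcsin (A / √(A ^ 2 + s ^ 2)) = Real.pi / 2 - Real.arctan (s / A) := by
  have e : √(A ^ 2 + s ^ 2) = A * √(1 + (s / A) ^ 2) := by
    rw [Real.sqrt_eq_iff_mul_self_eq (by positivity) (by positivity)]
    rw [← sq, mul_pow, Real.sq_sqrt (by positivity)]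
    field_simp
  have hp := Real.arctan_pos.2 (div_pos hs hA)
  have hl := Real.arctan_lt_pi_div_two (s / A)
  apply Real.arcsin_eq_of_sin_eq
  · rw [Real.sin_pi_div_two_sub, Real.cos_arctan, e]
    field_simp
  · constructor <;> linarith

theorem cos_aux {β A s : ℝ} (hA : 0 < A) (hs : 0 < s) :
    Real.cos (Real.pi / 2 - Real.arctan (s / A) - β) =
      (s * Real.cos β + A * Real.sin β) / √(A ^ 2 + s ^ 2) := by
  have e : √(A ^ 2 + s ^ 2) = A * √(1 + (s / A) ^ 2) := by
    rw [Real.sqrt_eq_iff_mul_self_eq (by positivity) (by positivity)]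
    rw [← sq, mul_pow, Real.sq_sqrt (by positivity)]
    field_simp
  rw [Real.cos_sub, Real.cos_pi_div_two_sub, Real.sin_pi_div_two_sub, Real.cos_arctan,
    Real.sin_arctan, e]
  field_simp

theorem steady_iff {β A s : ℝ} (hA : 0 < A) (hs : 0 < s) (hD : 0 < 1 - A ^ 2 - s ^ 2)
    (hc : Real.cos β < 0)
    (hP : A * Real.cos β + s * Real.sin β < 0)
    (hN : A * Real.cos β + s * Real.sin β - 2 * (1 - A ^ 2 - s ^ 2) * A * Real.cos β < 0) :
    SteadyStatePi β A s ↔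
      A * Real.arsinh (s / A) + (1 - A ^ 2 - s ^ 2) * Hfun β A s = 0 := by
  unfold SteadyStatePi
  simp only
  rw [arcosh_eq hA hs, arcsin_eq_aux hA hs]
  have eN : (2 * A ^ 2 + 2 * s ^ 2 - 1) * A * Real.cos β + s * Real.sin β =
    A * Real.cos β + s * Real.sin β - 2 * (1 - A ^ 2 - s ^ 2) * A * Real.cos β := by ring
  rw [eN]
  unfold Hfun
  rw [← cos_aux hA hs]
  have hNP : A * Real.cos β + s * Real.sin β <
    A * Real.cos β + s * Real.sin β - 2 * (1 - A ^ 2 - s ^ 2) * A * Real.cos β := by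
    have : 0 < (1 - A ^ 2 - s ^ 2) * A * (- Real.cos β) := mul_pos (mul_pos hD hA) (by linarith)
    linarith
  generalize Real.pi / 2 - Real.arctan (s / A) - β = θ
  generalize A * Real.arsinh (s / A) = z
  set D := 1 - A ^ 2 - s ^ 2
  set P := A * Real.cos β + s * Real.sin β
  set N := P - 2 * D * A * Real.cos β
  clear_value D P N
  have hq : 0 < N / P := div_pos_of_neg_of_neg hN hP
  have c1 : P / D < 0 := div_neg_of_neg_of_pos hP hD
  have c2 : 0 < √(N / P) := Real.sqrt_pos.2 hq
  have c3 : √(N / P) < 1 := by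
    rw [Real.sqrt_lt' one_pos, one_pow]
    rw [div_lt_one_of_neg hP]; exact hNP
  have hm : 0 < 4 * P * N := by nlinarith
  have hI : (∫ x in θ..Real.pi, ((Real.sin x) ^ 2 / √((Real.sin x) ^ 2 + 4 * (P / D) ^ 2 * √(N / P) ^ 2)
          - Real.sin x)) = D * LInt θ D (4 * P * N) - 1 - Real.cos θ := by
    have e : ∀ x, (Real.sin x) ^ 2 / √((Real.sin x) ^ 2 + 4 * (P / D) ^ 2 * √(N / P) ^ 2)
          - Real.sin x = D * gInt D (4 * P * N) x - Real.sin x := by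
      intro x
      congr 1
      unfold gInt
      have : √(D ^ 2 * (Real.sin x) ^ 2 + 4 * P * N) =
          D * √((Real.sin x) ^ 2 + 4 * (P / D) ^ 2 * √(N / P) ^ 2) := by
        rw [Real.sqrt_eq_iff_mul_self_eq (by positivity) (by positivity)]
        rw [← sq, mul_pow, Real.sq_sqrt (by positivity), Real.sq_sqrt hq.le]
        field_simp [hP.ne]
      rw [this]
      have : 0 < √((Real.sin x) ^ 2 + 4 * (P / D) ^ 2 * √(N / P) ^ 2) := by
        apply Real.sqrt_pos.2
        have := sq_pos_of_neg c1
        positivity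
      field_simp
    simp only [e]
    rw [intervalIntegral.integral_sub (((gInt_cont D hm).const_mul D).intervalIntegrable _ _)
      (Real.continuous_sin.intervalIntegrable _ _), intervalIntegral.integral_const_mul, integral_sin,
      Real.cos_pi]
    unfold LInt
    ring
  rw [hI]
  have e2 : z - 1 / (2 * (P / D)) * (D * LInt θ D (4 * P * N) - 1 - Real.cos θ) =
    z + D * ((1 + Real.cos θ - D * LInt θ D (4 * P * N)) / (2 * P)) := by
    field_simp [hP.ne]
    ring
  rw [e2]
  exact ⟨fun h => h.2.2.2, fun h => ⟨c1, c2, c3, h⟩⟩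

theorem steady_states_theta_c_pi :
    ∀ β ∈ Set.Ioo (Real.pi / 2) Real.pi,
      ∃ ε ∈ Set.Ioo (0:ℝ) 1, ∃ C : ℝ, 0 < C ∧ ∃ σ : ℝ → ℝ,
        ContinuousOn σ (Set.Ioo (1 - ε) 1) ∧
        (∀ A ∈ Set.Ioo (1 - ε) 1,
          (0 < σ A ∧ σ A < Real.sqrt (1 - A ^ 2)) ∧
          SteadyStatePi β A (σ A) ∧
          (∀ s : ℝ, 0 < s → s < Real.sqrt (1 - A ^ 2) → SteadyStatePi β A s → s = σ A) ∧
          |σ A - ((Real.sin β + 1) / (-Real.cos β)) * (1 - A)| ≤ C * (1 - A) ^ 2) ∧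
        Filter.Tendsto σ (nhdsWithin 1 (Set.Iio 1)) (nhds 0) := by
  intro β hβ
  have hc : Real.cos β < 0 :=
    Real.cos_neg_of_pi_div_two_lt_of_lt hβ.1 (by linarith [hβ.2, Real.pi_pos])
  have hS : 0 < Real.sin β := Real.sin_pos_of_pos_of_lt_pi (by linarith [hβ.1, Real.pi_pos]) hβ.2
  obtain ⟨K, r, hK, hr, lip⟩ := Hfun_lip β hc
  have hH0 : Hfun β 1 0 = (1 + Real.sin β) / (2 * Real.cos β) := by
    unfold Hfun
    simp
  have hneg : (1 + Real.sin β) / (2 * Real.cos β) < 0 :=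
    div_neg_of_pos_of_neg (by linarith) (by linarith)
  have hopen : IsOpen {p : ℝ × ℝ | 0 < p.1 ∧ p.1 * Real.cos β + p.2 * Real.sin β < 0 ∧
      p.1 * Real.cos β + p.2 * Real.sin β - 2 * (1 - p.1 ^ 2 - p.2 ^ 2) * p.1 * Real.cos β < 0} := by
    refine IsOpen.and (isOpen_lt (by fun_prop) (by fun_prop)) ?_
    exact IsOpen.and (isOpen_lt (by fun_prop) (by fun_prop)) (isOpen_lt (by fun_prop) (by fun_prop))
  obtain ⟨δ, hδ, hδt⟩ := Metric.nhds_basis_closedBall.mem_iff.1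
    (hopen.mem_nhds (x := ((1:ℝ), (0:ℝ))) (by simpa using hc))
  obtain ⟨ε, hε, hεδ, hsq, C, hC, σ, hcont, hall, htend⟩ :=
    core (Hfun β) _ K r δ hr hδ hK hH0 hneg lip
  refine ⟨ε, hε, C, hC, σ, hcont, ?_, htend⟩
  intro A hA
  have key : ∀ s, 0 < s → s < √(1 - A ^ 2) → (SteadyStatePi β A s ↔
      A * Real.arsinh (s / A) + (1 - A ^ 2 - s ^ 2) * Hfun β A s = 0) := by
    intro s hs hs'
    have hmem : (A, s) ∈ Metric.closedBall ((1:ℝ), (0:ℝ)) δ := by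
      rw [Metric.mem_closedBall, Prod.dist_eq]
      simp only [Real.dist_eq, sub_zero]
      apply max_le
      · rw [abs_le]; constructor <;> linarith [hA.1, hA.2]
      · rw [abs_of_pos hs]; exact hs'.le.trans (hsq A hA)
    obtain ⟨m1, m2, m3⟩ := hδt hmem
    refine steady_iff m1 hs ?_ hc m2 m3
    rw [Real.lt_sqrt hs.le] at hs'
    linarith
  obtain ⟨⟨a1, a2⟩, a3, a4, a5⟩ := hall A hA
  refine ⟨⟨a1, a2⟩, (key _ a1 a2).2 a3, fun s h1 h2 h3 => a4 s h1 h2 ((key s h1 h2).1 h3), ?_⟩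
  have e : σ A - ((Real.sin β + 1) / (-Real.cos β)) * (1 - A) =
      σ A + 2 * ((1 + Real.sin β) / (2 * Real.cos β)) * (1 - A) := by
    field_simp [hc.ne]
    ring
  rw [e]; exact a5
end
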